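/- Let M = M(S; F(I), G(Lambda); P) be a Rees matrix semigroup without zero over a semigroupoid S (so the sandwich matrix P has no zero entries). Suppose the set of non-identity arrows of S is weakly right-ideal-generated by a row cross-section of P. If M is an automatic semigroup then S is automatic. -/

import Mathlib

/- Common framework: graphs, path languages, synchronous regularity,
   semigroupoids, automatic structures, and Rees matrix constructions. -/

namespace AutoRees

/-- Raw data of a semigroupoid: source and target maps on arrows together with a
totalised multiplication (whose values are only meaningful on composable pairs). -/
structure PreSgpd (O A : Type) where
  src : A → O
  tgt : A → O
  mul : A → A → A

/-- A semigroupoid: the multiplication respects sources and targets and is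
associative, on composable pairs. -/
structure Sgpd (O A : Type) extends PreSgpd O A where
  src_mul : ∀ e f, tgt e = src f → src (mul e f) = src e
  tgt_mul : ∀ e f, tgt e = src f → tgt (mul e f) = tgt f
  mul_assoc' : ∀ e f g, tgt e = src f → tgt f = src g →
    mul (mul e f) g = mul e (mul f g)

/-- Evaluate a nonempty word of edge labels as a product in the semigroupoid
(`none` on the empty word). -/
def evalPath? {O A E : Type} (S : PreSgpd O A) (lab : E → A) : List E → Option A
  | [] => none
  | e :: l => some ((l.map lab).foldl S.mul (lab e))

/-- The consecutive-compatibility condition making a list of edges a path. -/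
def IsPathChain {V E : Type} (esrc etgt : E → V) (l : List E) : Prop :=
  List.Chain' (fun e f => etgt e = esrc f) l

/-- The target of a non-empty path. -/
def pathTgt? {V E : Type} (etgt : E → V) (l : List E) : Option V :=
  l.getLast?.map etgt

/-- The source of a non-empty path. -/
def pathSrc? {V E : Type} (esrc : E → V) (l : List E) : Option V :=
  l.head?.map esrc

/-- A set of words is regular if it is a regular language in the usual sense. -/
def IsRegularSet {α : Type} (L : Set (List α)) : Prop :=
  Language.IsRegular (show Language α from L)

/-- The padding symbol used to pad a pair of paths, at the target of `l`
(the letters of the padded alphabet `X^$` are `Sum.inl` (a genuine edge) or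
`Sum.inr (some v)` (the padding edge at vertex `v`)). -/
def padSym {V E : Type} (etgt : E → V) (l : List E) : E ⊕ Option V :=
  Sum.inr (l.getLast?.map etgt)

/-- The padded convolution `(a, b) δ_X` of a pair of paths. -/
def deltaPair {V E : Type} (etgt : E → V) (a b : List E) :
    List ((E ⊕ Option V) × (E ⊕ Option V)) :=
  (a.map Sum.inl).zip (b.map Sum.inl) ++
    (if a.length ≤ b.length
      then (b.drop a.length).map (fun e => (padSym etgt a, Sum.inl e))
      else (a.drop b.length).map (fun e => (Sum.inl e, padSym etgt b)))

/-- A binary relation on paths is synchronously regular if its image under the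
padding map is a regular language over the padded product alphabet. -/
def SyncRegular {V E : Type} (etgt : E → V) (R : Set (List E × List E)) : Prop :=
  IsRegularSet { w | ∃ p ∈ R, w = deltaPair etgt p.1 p.2 }

/-- A choice of representatives `(X, K, ρ)` for a semigroupoid `S`: a graph `X`
with vertex set `S^0` (edge set `E`, source `esrc`, target `etgt`), a semigroupoid
morphism `ρ : X^+ → S` (induced by the edge-labelling `lab`), and a language `K`
of non-empty paths with `K ρ = S^1`. -/
structure ChoiceOfReps {O A : Type} (S : PreSgpd O A) (E : Type) where
  esrc : E → O
  etgt : E → O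
  lab : E → A
  lab_src : ∀ e, S.src (lab e) = esrc e
  lab_tgt : ∀ e, S.tgt (lab e) = etgt e
  K : Set (List E)
  K_path : ∀ l ∈ K, l ≠ [] ∧ IsPathChain esrc etgt l
  K_onto : ∀ a : A, ∃ l ∈ K, evalPath? S lab l = some a

variable {O A E : Type} {S : PreSgpd O A}

/-- The relation `K_=` = {(u,v) ∈ K × K : u ρ = v ρ}. -/
def relEq (C : ChoiceOfReps S E) : Set (List E × List E) :=
  { p | p.1 ∈ C.K ∧ p.2 ∈ C.K ∧ evalPath? S C.lab p.1 = evalPath? S C.lab p.2 }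

/-- The relation `K_a` for an edge `a` of `X`. -/
def relEdge (C : ChoiceOfReps S E) (a : E) : Set (List E × List E) :=
  { p | p.1 ∈ C.K ∧ p.2 ∈ C.K ∧ pathTgt? C.etgt p.1 = some (C.esrc a) ∧
        evalPath? S C.lab (p.1 ++ [a]) = evalPath? S C.lab p.2 }

/-- The relation `K_a` for a vertex `a` of `X` (regarded as the empty path at `a`). -/
def relVertex (C : ChoiceOfReps S E) (v : O) : Set (List E × List E) :=
  { p | p.1 ∈ C.K ∧ p.2 ∈ C.K ∧ pathTgt? C.etgt p.1 = some v ∧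
        evalPath? S C.lab p.1 = evalPath? S C.lab p.2 }

/-- An automatic structure: a finitely generated choice of representatives with
`K` regular such that `K_a` is synchronously regular for every edge and vertex. -/
def IsAutomaticStructure (C : ChoiceOfReps S E) : Prop :=
  Finite E ∧ IsRegularSet C.K ∧
    (∀ a : E, SyncRegular C.etgt (relEdge C a)) ∧
    (∀ v : O, SyncRegular C.etgt (relVertex C v))

/-- The set of non-empty prefixes of words in `K`. -/
def prefs {E : Type} (K : Set (List E)) : Set (List E) :=
  { p | p ≠ [] ∧ ∃ l ∈ K, p <+: l }

/-- The relation `K'_=` = {(u,v) ∈ K × Pref(K) : u ρ = v ρ}. -/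
def relPrefEq (C : ChoiceOfReps S E) : Set (List E × List E) :=
  { p | p.1 ∈ C.K ∧ p.2 ∈ prefs C.K ∧ evalPath? S C.lab p.1 = evalPath? S C.lab p.2 }

/-- A prefix-automatic structure. -/
def IsPrefixAutomaticStructure (C : ChoiceOfReps S E) : Prop :=
  IsAutomaticStructure C ∧ SyncRegular C.etgt (relPrefEq C)

/-- A cross-section: `ρ` restricted to `K` is injective. -/
def IsCrossSection (C : ChoiceOfReps S E) : Prop :=
  ∀ u ∈ C.K, ∀ v ∈ C.K, evalPath? S C.lab u = evalPath? S C.lab v → u = v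

/-- `K` is closed under taking non-empty prefixes. -/
def IsPrefixClosed (C : ChoiceOfReps S E) : Prop :=
  ∀ l ∈ C.K, ∀ p : List E, p ≠ [] → p <+: l → p ∈ C.K

/-- A semigroupoid (or semigroup, in the one-object case) is automatic if it
admits an automatic structure. -/
def IsAutomatic (S : PreSgpd O A) : Prop :=
  ∃ (E : Type) (C : ChoiceOfReps S E), IsAutomaticStructure C

/-- Prefix-automaticity. -/
def IsPrefixAutomatic (S : PreSgpd O A) : Prop :=
  ∃ (E : Type) (C : ChoiceOfReps S E), IsPrefixAutomaticStructure C

/-- Finite generation: every arrow is a (composable) product of arrows from some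
fixed finite set. -/
def IsFG (S : PreSgpd O A) : Prop :=
  ∃ T : Set A, T.Finite ∧ ∀ a : A, ∃ l : List A, l ≠ [] ∧ (∀ x ∈ l, x ∈ T) ∧
    IsPathChain S.src S.tgt l ∧ evalPath? S id l = some a

/-- An arrow is an identity if it acts as an identity on all composable products. -/
def IsIdentity (S : PreSgpd O A) (e : A) : Prop :=
  (∀ x, S.tgt e = S.src x → S.mul e x = x) ∧ (∀ y, S.tgt y = S.src e → S.mul y e = y)

/-- A small category is a semigroupoid with an identity arrow at every object. -/
def IsSmallCategory (S : PreSgpd O A) : Prop :=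
  ∀ v : O, ∃ e : A, S.src e = v ∧ S.tgt e = v ∧ IsIdentity S e

/-- No object is isolated. -/
def IsolationFree (S : PreSgpd O A) : Prop :=
  ∀ v : O, ∃ a : A, S.src a = v ∨ S.tgt a = v

namespace Rees

variable {O A I Λ : Type}

/-- A triple `(i, x, λ)` is valid if `i F = x α` and `x ω = λ G`. -/
def Valid (S : Sgpd O A) (F : I → O) (G : Λ → O) (t : I × A × Λ) : Prop :=
  F t.1 = S.src t.2.1 ∧ S.tgt t.2.1 = G t.2.2

/-- The set of valid Rees triples. -/
def Triples (S : Sgpd O A) (F : I → O) (G : Λ → O) : Type :=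
  { t : I × A × Λ // Valid S F G t }

theorem prod_valid (S : Sgpd O A) {F : I → O} {G : Λ → O}
    {i : I} {x : A} {lam : Λ} {j : I} {y : A} {mu : Λ} {p : A}
    (hx : Valid S F G (i, x, lam)) (hy : Valid S F G (j, y, mu))
    (hps : S.src p = G lam) (hpt : S.tgt p = F j) :
    Valid S F G (i, S.mul (S.mul x p) y, mu) := by
  obtain ⟨hx1, hx2⟩ := hx
  obtain ⟨hy1, hy2⟩ := hy
  have h1 : S.tgt x = S.src p := by rw [hps]; exact hx2
  have h2 : S.tgt p = S.src y := by rw [hpt]; exact hy1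
  have h3 : S.tgt (S.mul x p) = S.src y := by rw [S.tgt_mul x p h1]; exact h2
  constructor
  · show F i = S.src (S.mul (S.mul x p) y)
    rw [S.src_mul _ y h3, S.src_mul x p h1]; exact hx1
  · show S.tgt (S.mul (S.mul x p) y) = G mu
    rw [S.tgt_mul _ y h3]; exact hy2

/-- Data for a Rees matrix construction with zero over a semigroupoid `S`:
indexing functions `F`, `G` surjective onto the sets of sources and of targets
respectively, and a sandwich matrix `P` with entries in `S^1 ∪ {0}`
(`none` representing `0`) compatible with `F` and `G`. -/
structure Data0 (S : Sgpd O A) (I Λ : Type) where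
  F : I → O
  G : Λ → O
  P : Λ → I → Option A
  F_into : ∀ i, ∃ a : A, S.src a = F i
  F_onto : ∀ a : A, ∃ i, F i = S.src a
  G_into : ∀ lam, ∃ a : A, S.tgt a = G lam
  G_onto : ∀ a : A, ∃ lam, G lam = S.tgt a
  P_src : ∀ lam i p, P lam i = some p → S.src p = G lam
  P_tgt : ∀ lam i p, P lam i = some p → S.tgt p = F i

/-- Underlying set of the Rees matrix semigroup with zero (`none` is the zero). -/
def Carrier0 (S : Sgpd O A) (R : Data0 S I Λ) : Type :=
  Option (Triples S R.F R.G)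

/-- Multiplication of the Rees matrix semigroup with zero. -/
def mul0 (S : Sgpd O A) (R : Data0 S I Λ) :
    Carrier0 S R → Carrier0 S R → Carrier0 S R
  | some ⟨(i, x, lam), hx⟩, some ⟨(j, y, mu), hy⟩ =>
    match hp : R.P lam j with
    | some p => some ⟨(i, S.mul (S.mul x p) y, mu),
        prod_valid S hx hy (R.P_src lam j p hp) (R.P_tgt lam j p hp)⟩
    | none => none
  | none, _ => none
  | _, none => none

/-- The Rees matrix semigroup with zero `M^0(S; F(I), G(Λ); P)`, as a
one-object semigroupoid (i.e. a semigroup). -/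
def pre0 (S : Sgpd O A) (R : Data0 S I Λ) : PreSgpd Unit (Carrier0 S R) where
  src _ := ()
  tgt _ := ()
  mul := mul0 S R

/-- Data for a Rees matrix construction without zero (no zero entries in `P`). -/
structure Data (S : Sgpd O A) (I Λ : Type) where
  F : I → O
  G : Λ → O
  P : Λ → I → A
  F_into : ∀ i, ∃ a : A, S.src a = F i
  F_onto : ∀ a : A, ∃ i, F i = S.src a
  G_into : ∀ lam, ∃ a : A, S.tgt a = G lam
  G_onto : ∀ a : A, ∃ lam, G lam = S.tgt a
  P_src : ∀ lam i, S.src (P lam i) = G lam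
  P_tgt : ∀ lam i, S.tgt (P lam i) = F i

/-- Underlying set of the Rees matrix semigroup without zero. -/
def Carrier (S : Sgpd O A) (R : Data S I Λ) : Type :=
  Triples S R.F R.G

/-- Multiplication of the Rees matrix semigroup without zero. -/
def mul (S : Sgpd O A) (R : Data S I Λ) :
    Carrier S R → Carrier S R → Carrier S R
  | ⟨(i, x, lam), hx⟩, ⟨(j, y, mu), hy⟩ =>
    ⟨(i, S.mul (S.mul x (R.P lam j)) y, mu),
      prod_valid S hx hy (R.P_src lam j) (R.P_tgt lam j)⟩

/-- The Rees matrix semigroup without zero `M(S; F(I), G(Λ); P)`, as a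
one-object semigroupoid (i.e. a semigroup). -/
def pre (S : Sgpd O A) (R : Data S I Λ) : PreSgpd Unit (Carrier S R) where
  src _ := ()
  tgt _ := ()
  mul := mul S R

/-- The set `S P' S` of arrows of the form `s p t` with `p` a non-zero entry of `P`. -/
def SPS0 (S : Sgpd O A) (R : Data0 S I Λ) : Set A :=
  { a | ∃ s p t lam i, R.P lam i = some p ∧ S.tgt s = S.src p ∧ S.tgt p = S.src t ∧
        a = S.mul (S.mul s p) t }

/-- The set `S P S` for a matrix without zero entries. -/
def SPS (S : Sgpd O A) (R : Data S I Λ) : Set A :=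
  { a | ∃ s t lam i, S.tgt s = S.src (R.P lam i) ∧ S.tgt (R.P lam i) = S.src t ∧
        a = S.mul (S.mul s (R.P lam i)) t }

/-- The set of targets of arrows of `S` (the codomain of `G`). -/
def tgtSet (S : Sgpd O A) : Set O := { v | ∃ a : A, S.tgt a = v }

/-- `T` is strongly right-ideal-generated by a row cross-section of `P`. -/
def StronglyRIG0 (S : Sgpd O A) (R : Data0 S I Λ) (T : Set A) : Prop :=
  ∃ Λ' : Set Λ, Set.BijOn R.G Λ' (tgtSet S) ∧
    ∀ t ∈ T, ∃ lam ∈ Λ', ∃ i p s, R.P lam i = some p ∧ S.tgt p = S.src s ∧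
      t = S.mul p s

/-- `T` is weakly right-ideal-generated by a row cross-section of `P`. -/
def WeaklyRIG0 (S : Sgpd O A) (R : Data0 S I Λ) (T : Set A) : Prop :=
  ∃ Λ' : Set Λ, Set.BijOn R.G Λ' (tgtSet S) ∧
    ∀ t ∈ T, ∃ lam ∈ Λ', ∃ i p, R.P lam i = some p ∧
      (t = p ∨ ∃ s, S.tgt p = S.src s ∧ t = S.mul p s)

/-- Weak right-ideal generation, for a matrix without zero entries. -/
def WeaklyRIG (S : Sgpd O A) (R : Data S I Λ) (T : Set A) : Prop :=
  ∃ Λ' : Set Λ, Set.BijOn R.G Λ' (tgtSet S) ∧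
    ∀ t ∈ T, ∃ lam ∈ Λ', ∃ i,
      (t = R.P lam i ∨ ∃ s, S.tgt (R.P lam i) = S.src s ∧ t = S.mul (R.P lam i) s)

end Rees


section Regular

theorem reg_of_nfa {α σ : Type} [Finite σ] (acc : σ → List α → Prop) (step : σ → α → σ → Prop)
    (h : ∀ s a w, acc s (a :: w) ↔ ∃ t, step s a t ∧ acc t w) (s : σ) :
    IsRegularSet {w | acc s w} := by
  classical
  have : Fintype σ := Fintype.ofFinite σ
  let M : NFA α σ := ⟨fun s a => {t | step s a t}, {s}, {t | acc t []}⟩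
  have key : ∀ (w : List α) (X : Set σ), w ∈ M.acceptsFrom X ↔ ∃ t ∈ X, acc t w := by
    intro w
    induction w with
    | nil => intro X; rw [NFA.nil_mem_acceptsFrom]; rfl
    | cons a w ih =>
      intro X
      rw [NFA.cons_mem_acceptsFrom, ih]
      constructor
      · rintro ⟨t, ht, hw⟩
        rw [NFA.mem_stepSet] at ht
        obtain ⟨r, hr, hrt⟩ := ht
        exact ⟨r, hr, (h r a w).2 ⟨t, hrt, hw⟩⟩
      · rintro ⟨r, hr, hw⟩
        obtain ⟨t, hrt, hw⟩ := (h r a w).1 hw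
        exact ⟨t, NFA.mem_stepSet.2 ⟨r, hr, hrt⟩, hw⟩
  refine ⟨Set σ, inferInstance, M.toDFA, ?_⟩
  rw [NFA.toDFA_correct, NFA.accepts_eq_acceptsFrom_start]
  apply Set.ext
  intro w
  refine (key w _).trans ?_
  constructor
  · rintro ⟨t, ht, hw⟩
    have : t = s := ht
    subst this; exact hw
  · intro hw; exact ⟨s, rfl, hw⟩

theorem reg_dfa {α : Type} {L : Set (List α)} (h : IsRegularSet L) :
    ∃ (σ : Type) (_ : Finite σ) (M : DFA α σ), ∀ w, w ∈ L ↔ M.evalFrom M.start w ∈ M.accept := by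
  obtain ⟨σ, hf, M, hM⟩ := h
  refine ⟨σ, inferInstance, M, fun w => ?_⟩
  have : (w ∈ M.accepts) = (w ∈ L) := by rw [hM]; rfl
  rw [← this]; rfl

theorem reg_congr {α : Type} {L L' : Set (List α)} (h : IsRegularSet L)
    (hh : ∀ w, w ∈ L' ↔ w ∈ L) : IsRegularSet L' := by
  have : L' = L := Set.ext hh
  rw [this]; exact h

theorem reg_inter {α : Type} {L L' : Set (List α)} (h : IsRegularSet L) (h' : IsRegularSet L') :
    IsRegularSet {w | w ∈ L ∧ w ∈ L'} :=
  Language.IsRegular.inf h h'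

theorem reg_union {α : Type} {L L' : Set (List α)} (h : IsRegularSet L) (h' : IsRegularSet L') :
    IsRegularSet {w | w ∈ L ∨ w ∈ L'} :=
  Language.IsRegular.add h h'

theorem reg_empty {α : Type} : IsRegularSet (∅ : Set (List α)) := by
  have := reg_of_nfa (α := α) (σ := Unit) (fun _ _ => False) (fun _ _ _ => False) (by simp) ()
  exact this

theorem reg_comap {α β : Type} (f : α → β) {L : Set (List β)} (h : IsRegularSet L) :
    IsRegularSet {w : List α | w.map f ∈ L} := by
  obtain ⟨σ, _, M, hM⟩ := reg_dfa h
  have := reg_of_nfa (fun s (w : List α) => M.evalFrom s (w.map f) ∈ M.accept)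
    (fun s a t => t = M.step s (f a)) (by intro s a w; simp) M.start
  convert this using 3
  exact hM _

theorem reg_map {α β : Type} (f : α → β) {L : Set (List α)} (h : IsRegularSet L) :
    IsRegularSet {w : List β | ∃ x ∈ L, x.map f = w} := by
  obtain ⟨σ, _, M, hM⟩ := reg_dfa h
  have := reg_of_nfa (fun s (w : List β) => ∃ x, M.evalFrom s x ∈ M.accept ∧ x.map f = w)
    (fun s b t => ∃ a, f a = b ∧ t = M.step s a) (by
      intro s b w
      constructor
      · rintro ⟨x, hx, hw⟩
        cases x with
        | nil => simp at hw
        | cons a x =>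
          simp only [List.map_cons, List.cons.injEq] at hw
          exact ⟨_, ⟨a, hw.1, rfl⟩, x, by simpa using hx, hw.2⟩
      · rintro ⟨_, ⟨a, rfl, rfl⟩, x, hx, rfl⟩
        exact ⟨a :: x, by simpa using hx, by simp⟩) M.start
  simpa only [hM] using this

theorem reg_ext {α : Type} (c : α) {L : Set (List α)} (h : IsRegularSet L) :
    IsRegularSet {w : List α | ∃ x ∈ L, ∃ k, w = x ++ List.replicate k c} := by
  obtain ⟨σ, _, M, hM⟩ := reg_dfa h
  have := reg_of_nfa (σ := Option σ)
    (fun s (w : List α) => match s with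
      | none => ∃ k, w = List.replicate k c
      | some s => ∃ x, M.evalFrom s x ∈ M.accept ∧ ∃ k, w = x ++ List.replicate k c)
    (fun s a t => match s, t with
      | none, none => a = c
      | none, some _ => False
      | some s, none => s ∈ M.accept ∧ a = c
      | some s, some t => t = M.step s a) (by
      have hrep : ∀ a (w : List α), (∃ k, a :: w = List.replicate k c) ↔
          (a = c ∧ ∃ k, w = List.replicate k c) := by
        intro a w
        constructor
        · rintro ⟨k, hk⟩
          cases k with
          | zero => simp at hk
          | succ k =>
            rw [List.replicate_succ] at hk
            simp only [List.cons.injEq] at hk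
            exact ⟨hk.1, k, hk.2⟩
        · rintro ⟨rfl, k, rfl⟩
          exact ⟨k + 1, rfl⟩
      rintro (_ | s) a w
      · rw [Option.exists]
        simp only [false_and, exists_false, or_false]
        exact hrep a w
      · rw [Option.exists]
        simp only [exists_eq_left]
        constructor
        · rintro ⟨x, hx, k, hk⟩
          cases x with
          | nil =>
            left
            obtain ⟨h1, h2⟩ := (hrep a w).1 ⟨k, by simpa using hk⟩
            exact ⟨⟨by simpa using hx, h1⟩, h2⟩
          | cons b x =>
            right
            simp only [List.cons_append, List.cons.injEq] at hk
            obtain ⟨rfl, hk⟩ := hk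
            exact ⟨x, by simpa using hx, k, hk⟩
        · rintro (⟨⟨hs, rfl⟩, k, rfl⟩ | ⟨x, hx, k, rfl⟩)
          · exact ⟨[], by simpa using hs, k + 1, rfl⟩
          · exact ⟨a :: x, by simpa using hx, k, rfl⟩) (some M.start)
  simpa only [hM] using this

theorem reg_strip {α : Type} (c : α) {L : Set (List α)} (h : IsRegularSet L) :
    IsRegularSet {w : List α | ∃ k, w ++ List.replicate k c ∈ L} := by
  obtain ⟨σ, _, M, hM⟩ := reg_dfa h
  have := reg_of_nfa (fun s (w : List α) => ∃ k, M.evalFrom s (w ++ List.replicate k c) ∈ M.accept)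
    (fun s a t => t = M.step s a) (by intro s a w; simp) M.start
  simpa only [hM] using this

theorem reg_last {α : Type} (c : α) :
    IsRegularSet {w : List α | w.getLast? ≠ some c} := by
  have := reg_of_nfa (σ := Prop)
    (fun s (w : List α) => (w = [] → s) ∧ w.getLast? ≠ some c)
    (fun _ a t => t = (a ≠ c)) (by
      intro s a w
      cases w with
      | nil => simp
      | cons b w => simp [List.getLast?_cons_cons]) True
  convert this using 3
  simp

theorem reg_singleton {α : Type} (w : List α) : IsRegularSet {x : List α | x = w} := by
  have hf : Finite {s : List α // s <:+ w} := by
    have : ({s | s <:+ w} : Set (List α)).Finite := by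
      refine (List.finite_toSet w.tails).subset ?_
      intro s hs; simpa using hs
    exact this
  have := reg_of_nfa (σ := {s : List α // s <:+ w}) (fun s x => x = s.1)
    (fun s a t => s.1 = a :: t.1) (by
      rintro ⟨s, hs⟩ a x
      constructor
      · rintro rfl
        exact ⟨⟨x, (List.suffix_cons a x).trans hs⟩, rfl, rfl⟩
      · rintro ⟨t, h1, h2⟩
        subst h2; exact h1.symm) ⟨w, List.suffix_refl w⟩
  exact this

end Regular

section Padding

variable {E F H : Type}

/-- `p` is a padding of `u` by `none`s. -/
def Pd (p : List (Option E)) (u : List E) : Prop := ∀ i : ℕ, p[i]?.join = u[i]?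

/-- canonical padding -/
def pd (n : ℕ) (u : List E) : List (Option E) := (List.range n).map (fun i => u[i]?)

theorem Pd.unique {p : List (Option E)} {u v : List E} (h : Pd p u) (h' : Pd p v) : u = v := by
  apply List.ext_getElem?
  intro i
  rw [← h i, ← h' i]

theorem Pd.length_le {p : List (Option E)} {u : List E} (h : Pd p u) : u.length ≤ p.length := by
  by_contra hc
  push Not at hc
  have := h p.length
  rw [List.getElem?_eq_none le_rfl, List.getElem?_eq_getElem hc] at this
  simp at this

theorem Pd_append {p : List (Option E)} {u : List E} (k : ℕ) :
    Pd (p ++ List.replicate k none) u ↔ Pd p u := by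
  have : ∀ i : ℕ, (p ++ List.replicate k none)[i]?.join = p[i]?.join := by
    intro i
    rw [List.getElem?_append]
    split_ifs with hi
    · rfl
    · rw [List.getElem?_eq_none (not_lt.1 hi), List.getElem?_replicate]
      split_ifs <;> rfl
  simp only [Pd, this]

theorem Pd_pd {n : ℕ} {u : List E} (h : u.length ≤ n) : Pd (pd n u) u := by
  intro i
  unfold pd
  rw [List.getElem?_map]
  by_cases hi : i < n
  · simp [List.getElem?_range hi]
  · rw [List.getElem?_eq_none (by simpa using hi), List.getElem?_eq_none (by omega)]
    rfl

theorem Pd.eq_pd {p : List (Option E)} {u : List E} (h : Pd p u) : p = pd p.length u := by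
  apply List.ext_getElem (by simp [pd])
  intro i h1 h2
  have := h i
  rw [List.getElem?_eq_getElem h1] at this
  simpa [pd] using this

theorem pair_ext {α β : Type} {l l' : List (α × β)} (h1 : l.map Prod.fst = l'.map Prod.fst)
    (h2 : l.map Prod.snd = l'.map Prod.snd) : l = l' := by
  rw [← List.zip_unzip l, ← List.zip_unzip l', List.unzip_eq_map, List.unzip_eq_map]
  simp only
  rw [h1, h2]

theorem Pd_nil {u : List E} : Pd ([] : List (Option E)) u ↔ u = [] := by
  constructor
  · intro h
    have := h.length_le
    simpa using this
  · rintro rfl i; simp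

theorem Pd_some {p : List (Option E)} {e : E} {u : List E} :
    Pd (some e :: p) u ↔ ∃ u', u = e :: u' ∧ Pd p u' := by
  constructor
  · intro h
    cases u with
    | nil => have := h 0; simp at this
    | cons e' u =>
      have h0 := h 0
      simp at h0
      subst h0
      exact ⟨u, rfl, fun i => by simpa using h (i + 1)⟩
  · rintro ⟨u', rfl, h⟩ i
    cases i with
    | zero => simp
    | succ i => simpa using h i

theorem Pd_none {p : List (Option E)} {u : List E} :
    Pd (none :: p) u ↔ u = [] ∧ Pd p [] := by
  constructor
  · intro h
    cases u with
    | nil => exact ⟨rfl, fun i => by simpa using h (i + 1)⟩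
    | cons e' u => have h0 := h 0; simp at h0
  · rintro ⟨rfl, h⟩ i
    cases i with
    | zero => simp
    | succ i => simpa using h i

/-- padded language of a relation -/
def PadLang (R : Set (List E × List F)) : Set (List (Option E × Option F)) :=
  {w | ∃ u v, (u, v) ∈ R ∧ Pd (w.map Prod.fst) u ∧ Pd (w.map Prod.snd) v}

/-- automatic relation -/
def AR (R : Set (List E × List F)) : Prop := IsRegularSet (PadLang R)

theorem AR.swap {R : Set (List E × List F)} (h : AR R) : AR {p : List F × List E | (p.2, p.1) ∈ R} := by
  have := reg_comap Prod.swap h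
  refine reg_congr this fun w => ?_
  constructor
  · rintro ⟨u, v, h1, h2, h3⟩
    exact ⟨v, u, h1, by simpa [Function.comp_def] using h3, by simpa [Function.comp_def] using h2⟩
  · rintro ⟨v, u, h1, h2, h3⟩
    exact ⟨u, v, h1, by simpa [Function.comp_def] using h3, by simpa [Function.comp_def] using h2⟩

theorem AR.union {R R' : Set (List E × List F)} (h : AR R) (h' : AR R') :
    AR {p | p ∈ R ∨ p ∈ R'} := by
  have := reg_union h h'
  refine reg_congr this fun w => ?_
  constructor
  · rintro ⟨u, v, h1 | h1, h2, h3⟩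
    · exact Or.inl ⟨u, v, h1, h2, h3⟩
    · exact Or.inr ⟨u, v, h1, h2, h3⟩
  · rintro (⟨u, v, h1, h2, h3⟩ | ⟨u, v, h1, h2, h3⟩)
    · exact ⟨u, v, Or.inl h1, h2, h3⟩
    · exact ⟨u, v, Or.inr h1, h2, h3⟩

theorem AR.empty : AR (∅ : Set (List E × List F)) := by
  unfold AR
  convert reg_empty using 1
  apply Set.ext
  intro w
  constructor
  · rintro ⟨u, v, h1, h2, h3⟩; exact h1.elim
  · intro h; exact h.elim

theorem AR.iUnion {ι : Type} [Finite ι] (R : ι → Set (List E × List F)) (h : ∀ i, AR (R i)) :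
    AR {p | ∃ i, p ∈ R i} := by
  have key : ∀ s : Set ι, s.Finite → AR {p | ∃ i ∈ s, p ∈ R i} := by
    intro s hs
    induction s, hs using Set.Finite.induction_on with
    | empty => simpa using AR.empty
    | @insert a s _ _ ih =>
      have := (h a).union ih
      simpa only [Set.mem_ofPred_eq, Set.mem_insert_iff, or_and_right, exists_or, exists_eq_left] using this
  simpa using key Set.univ Set.finite_univ

theorem AR.comp {R : Set (List E × List F)} {R' : Set (List F × List H)} (h : AR R) (h' : AR R') :
    AR {p : List E × List H | ∃ m, (p.1, m) ∈ R ∧ (m, p.2) ∈ R'} := by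
  have h1 := reg_comap (fun t : Option E × Option F × Option H => (t.1, t.2.1)) h
  have h2 := reg_comap (fun t : Option E × Option F × Option H => t.2) h'
  have := reg_strip (none, none) (reg_map (fun t : Option E × Option F × Option H => (t.1, t.2.2))
    (reg_inter h1 h2))
  refine reg_congr this fun w => ?_
  constructor
  · rintro ⟨u, v, ⟨m, hm, hm'⟩, hu, hv⟩
    simp only at hm hm'
    have lu := hu.length_le
    have lv := hv.length_le
    simp only [List.length_map] at lu lv
    refine ⟨m.length, (List.range (w.length + m.length)).map (fun i => (u[i]?, m[i]?, v[i]?)),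
      ⟨⟨u, m, hm, ?_, ?_⟩, ⟨m, v, hm', ?_, ?_⟩⟩, ?_⟩
    · simp only [List.map_map, Function.comp_def]; exact Pd_pd (by omega)
    · simp only [List.map_map, Function.comp_def]; exact Pd_pd (by omega)
    · simp only [List.map_map, Function.comp_def]; exact Pd_pd (by omega)
    · simp only [List.map_map, Function.comp_def]; exact Pd_pd (by omega)
    · have hu' := ((Pd_append m.length).2 hu).eq_pd
      have hv' := ((Pd_append m.length).2 hv).eq_pd
      apply pair_ext
      · simp only [List.map_map, Function.comp_def, List.map_append, List.map_replicate]
        rw [hu']; simp [pd]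
      · simp only [List.map_map, Function.comp_def, List.map_append, List.map_replicate]
        rw [hv']; simp [pd]
  · rintro ⟨k, t, ⟨⟨u, m, hR, hu, hm⟩, ⟨m', v, hR', hm', hv⟩⟩, ht⟩
    have e1 := congrArg (List.map Prod.fst) ht
    have e2 := congrArg (List.map Prod.snd) ht
    simp only [List.map_map, Function.comp_def, List.map_append, List.map_replicate] at *
    rw [e1, Pd_append] at hu
    rw [e2, Pd_append] at hv
    obtain rfl := hm.unique hm'
    exact ⟨u, v, ⟨m, hR, hR'⟩, hu, hv⟩

theorem AR.diag {R : Set (List E × List E)} (h : AR R) : IsRegularSet {u | (u, u) ∈ R} := by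
  have := reg_comap (fun e : E => (some e, some e)) h
  convert this using 3 with y
  have hy : Pd (y.map some) y := by intro i; rw [List.getElem?_map]; cases y[i]? <;> rfl
  constructor
  · intro h
    refine ⟨y, y, h, ?_, ?_⟩ <;> simpa only [List.map_map, Function.comp_def] using hy
  · rintro ⟨u, v, h, hu, hv⟩
    simp only [List.map_map, Function.comp_def] at hu hv
    obtain rfl := hu.unique hy
    obtain rfl := hv.unique hy
    exact h

end Padding

section Delta

variable {V E : Type}

theorem map_fst_zip_take {α β : Type} (x : List α) (y : List β) :
    (x.zip y).map Prod.fst = x.take y.length := by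
  induction x generalizing y with
  | nil => simp
  | cons a x ih => cases y <;> simp [ih]

theorem map_snd_zip_take {α β : Type} (x : List α) (y : List β) :
    (x.zip y).map Prod.snd = y.take x.length := by
  induction x generalizing y with
  | nil => simp
  | cons a x ih => cases y <;> simp [ih]

theorem delta_fst (etgt : E → V) (a b : List E) :
    (deltaPair etgt a b).map Prod.fst =
      a.map Sum.inl ++ List.replicate (b.length - a.length) (padSym etgt a) := by
  unfold deltaPair
  rw [List.map_append, map_fst_zip_take, List.length_map, ← List.map_take]
  split_ifs with h
  · rw [List.map_map, List.take_of_length_le h]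
    congr 1
    simp [Function.comp_def, List.map_const']
  · have h' : b.length - a.length = 0 := by omega
    rw [h', List.map_map]
    simp only [Function.comp_def, List.replicate_zero, List.append_nil]
    rw [← List.map_append, List.take_append_drop]

theorem delta_snd (etgt : E → V) (a b : List E) :
    (deltaPair etgt a b).map Prod.snd =
      b.map Sum.inl ++ List.replicate (a.length - b.length) (padSym etgt b) := by
  unfold deltaPair
  rw [List.map_append, map_snd_zip_take, List.length_map, ← List.map_take]
  split_ifs with h
  · have h' : a.length - b.length = 0 := by omega
    rw [h', List.map_map]
    simp only [Function.comp_def, List.replicate_zero, List.append_nil]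
    rw [← List.map_append, List.take_append_drop]
  · rw [List.map_map, List.take_of_length_le (by omega)]
    congr 1
    simp [Function.comp_def, List.map_const']

theorem delta_length (etgt : E → V) (a b : List E) :
    (deltaPair etgt a b).length = max a.length b.length := by
  have := congrArg List.length (delta_fst etgt a b)
  simp at this
  omega

/-- forget the pad vertex -/
def unpad (x : E ⊕ Option V) : Option E := x.getLeft?

theorem Pd_unpad (u : List E) (k : ℕ) (x : Option V) :
    Pd ((u.map Sum.inl ++ List.replicate k (Sum.inr x : E ⊕ Option V)).map unpad) u := by
  rw [List.map_append, List.map_replicate, List.map_map]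
  refine (Pd_append k).2 ?_
  intro i
  rw [List.getElem?_map]
  cases u[i]? <;> rfl

theorem delta_Pd_fst (etgt : E → V) (a b : List E) :
    Pd (((deltaPair etgt a b).map (Prod.map unpad unpad)).map Prod.fst) a := by
  have : ((deltaPair etgt a b).map (Prod.map unpad unpad)).map Prod.fst =
      ((deltaPair etgt a b).map Prod.fst).map unpad := by
    simp [Function.comp_def]
  rw [this, delta_fst]
  exact Pd_unpad _ _ _

theorem delta_Pd_snd (etgt : E → V) (a b : List E) :
    Pd (((deltaPair etgt a b).map (Prod.map unpad unpad)).map Prod.snd) b := by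
  have : ((deltaPair etgt a b).map (Prod.map unpad unpad)).map Prod.snd =
      ((deltaPair etgt a b).map Prod.snd).map unpad := by
    simp [Function.comp_def]
  rw [this, delta_snd]
  exact Pd_unpad _ _ _

theorem PadLang_eq (etgt : E → V) (R : Set (List E × List E)) (w : List (Option E × Option E)) :
    w ∈ PadLang R ↔ ∃ x ∈ {y | ∃ z ∈ { z | ∃ p ∈ R, z = deltaPair etgt p.1 p.2 },
      z.map (Prod.map unpad unpad) = y}, ∃ k, w = x ++ List.replicate k (none, none) := by
  constructor
  · rintro ⟨u, v, hR, hu, hv⟩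
    refine ⟨_, ⟨_, ⟨(u, v), hR, rfl⟩, rfl⟩, w.length - max u.length v.length, ?_⟩
    have lu := hu.length_le
    have lv := hv.length_le
    simp only [List.length_map] at lu lv
    have hlen := delta_length etgt u v
    have hu' := ((Pd_append (w.length - max u.length v.length)).2 (delta_Pd_fst etgt u v)).eq_pd
    have hv' := ((Pd_append (w.length - max u.length v.length)).2 (delta_Pd_snd etgt u v)).eq_pd
    apply pair_ext
    · rw [List.map_append, List.map_replicate]
      simp only
      rw [hu', hu.eq_pd]
      congr 1
      simp only [List.length_append, List.length_map, List.length_replicate, hlen]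
      omega
    · rw [List.map_append, List.map_replicate]
      simp only
      rw [hv', hv.eq_pd]
      congr 1
      simp only [List.length_append, List.length_map, List.length_replicate, hlen]
      omega
  · rintro ⟨_, ⟨_, ⟨⟨u, v⟩, hR, rfl⟩, rfl⟩, k, rfl⟩
    refine ⟨u, v, hR, ?_, ?_⟩
    · rw [List.map_append, List.map_replicate]
      exact (Pd_append k).2 (delta_Pd_fst etgt u v)
    · rw [List.map_append, List.map_replicate]
      exact (Pd_append k).2 (delta_Pd_snd etgt u v)

theorem AR_of_sync (etgt : E → V) {R : Set (List E × List E)} (h : SyncRegular etgt R) : AR R :=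
  reg_congr (reg_ext (none, none) (reg_map (Prod.map unpad unpad) h)) (PadLang_eq etgt R)

theorem AR_singleton (u v : List E) : AR {p : List E × List E | p = (u, v)} := by
  refine AR_of_sync (fun _ => ()) ?_
  refine reg_congr (reg_singleton (deltaPair (fun _ => ()) u v)) ?_
  intro w
  simp

/-- pad symbols are correct -/
def okp (etgt : E → V) : Option V → List (E ⊕ Option V) → Prop
  | _, [] => True
  | _, Sum.inl e :: c => okp etgt (some (etgt e)) c
  | cur, Sum.inr x :: c => x = cur ∧ okp etgt cur c

theorem reg_okp [Finite V] (etgt : E → V) : IsRegularSet {c | okp etgt none c} := by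
  refine reg_of_nfa (okp etgt) (fun s a t => match a with
    | Sum.inl e => t = some (etgt e)
    | Sum.inr x => x = s ∧ t = s) ?_ none
  rintro s (e | x) w
  · simp [okp]
  · simp [okp]

theorem okp_append (etgt : E → V) (u : List E) (k : ℕ) (cur : Option V) :
    okp etgt cur (u.map Sum.inl ++ List.replicate k (Sum.inr ((u.getLast?.map etgt).or cur))) := by
  induction u generalizing cur with
  | nil =>
    simp only [List.map_nil, List.nil_append, List.getLast?_nil, Option.map_none, Option.none_or]
    induction k with
    | zero => simp [okp]
    | succ k ih => rw [List.replicate_succ]; exact ⟨rfl, ih⟩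
  | cons e u ih =>
    have := ih (some (etgt e))
    simp only [List.map_cons, List.cons_append, okp]
    convert this using 4
    rw [List.getLast?_cons]
    cases u.getLast? <;> simp

theorem okp_eq (etgt : E → V) (c : List (E ⊕ Option V)) (u : List E) (cur : Option V)
    (hc : okp etgt cur c) (hp : Pd (c.map unpad) u) :
    c = u.map Sum.inl ++
      List.replicate (c.length - u.length) (Sum.inr ((u.getLast?.map etgt).or cur)) := by
  induction c generalizing u cur with
  | nil =>
    have := Pd_nil.1 hp
    subst this; simp
  | cons a c ih =>
    cases a with
    | inl e =>
      obtain ⟨u', rfl, hp2⟩ := Pd_some.1 hp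
      have := ih u' _ hc hp2
      simp only [List.map_cons, List.cons_append, List.length_cons, Nat.add_sub_add_right]
      congr 1
      convert this using 4
      rw [List.getLast?_cons]
      cases u'.getLast? <;> simp
    | inr x =>
      obtain ⟨rfl, hp2⟩ := Pd_none.1 hp
      obtain ⟨rfl, hc⟩ := hc
      have := ih [] _ hc hp2
      simp only [List.map_nil, List.nil_append, List.getLast?_nil, Option.map_none, Option.none_or,
        List.length_nil, Nat.sub_zero, List.length_cons] at this ⊢
      rw [List.replicate_succ]
      congr 1

theorem sync_of_AR [Finite V] (etgt : E → V) {R : Set (List E × List E)} (h : AR R) :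
    SyncRegular etgt R := by
  have h1 := reg_comap (Prod.map unpad unpad : (E ⊕ Option V) × (E ⊕ Option V) → _)
    (reg_inter h (reg_last (none, none)))
  have h2 := reg_inter (reg_comap (Prod.fst : (E ⊕ Option V) × (E ⊕ Option V) → _) (reg_okp etgt))
    (reg_comap (Prod.snd : (E ⊕ Option V) × (E ⊕ Option V) → _) (reg_okp etgt))
  refine reg_congr (reg_inter h1 h2) fun w => ?_
  constructor
  · rintro ⟨⟨u, v⟩, hR, rfl⟩
    refine ⟨⟨⟨u, v, hR, delta_Pd_fst _ _ _, delta_Pd_snd _ _ _⟩, ?_⟩, ?_, ?_⟩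
    · intro hl
      have hu := delta_Pd_fst etgt u v
      have hv := delta_Pd_snd etgt u v
      have hlen := delta_length etgt u v
      rw [List.getLast?_eq_getElem?] at hl
      have e1 := hu ((deltaPair etgt u v).length - 1)
      have e2 := hv ((deltaPair etgt u v).length - 1)
      simp only [List.length_map] at hl
      have hpos : 0 < (deltaPair etgt u v).length := by
        by_contra hc
        have : deltaPair etgt u v = [] := List.length_eq_zero_iff.1 (by omega)
        simp [this] at hl
      rw [List.getElem?_map, hl] at e1 e2
      have e1 := List.getElem?_eq_none_iff.1 e1.symm
      have e2 := List.getElem?_eq_none_iff.1 e2.symm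
      omega
    · show okp etgt none _
      rw [delta_fst]
      have := okp_append etgt u (v.length - u.length) none
      rwa [Option.or_none] at this
    · show okp etgt none _
      rw [delta_snd]
      have := okp_append etgt v (u.length - v.length) none
      rwa [Option.or_none] at this
  · rintro ⟨⟨⟨u, v, hR, hu, hv⟩, hl⟩, ou, ov⟩
    refine ⟨(u, v), hR, ?_⟩
    have lu := hu.length_le
    have lv := hv.length_le
    simp only [List.length_map] at lu lv
    have hlen : w.length = max u.length v.length := by
      by_contra hc
      apply hl
      rw [List.getLast?_eq_getElem?]
      have hlt : w.length - 1 < w.length := by omega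
      have e1 := hu (w.length - 1)
      have e2 := hv (w.length - 1)
      rw [List.getElem?_eq_none (show u.length ≤ w.length - 1 by omega)] at e1
      rw [List.getElem?_eq_none (show v.length ≤ w.length - 1 by omega)] at e2
      simp only [List.length_map]
      rw [List.getElem?_map, List.getElem?_map, List.getElem?_eq_getElem hlt] at e1 e2
      rw [List.getElem?_map, List.getElem?_eq_getElem hlt]
      simp only [Option.map_some, Option.join_some] at e1 e2 ⊢
      exact congrArg some (Prod.ext e1 e2)
    have eu := okp_eq etgt _ u none ou (by simpa [Function.comp_def] using hu)
    have ev := okp_eq etgt _ v none ov (by simpa [Function.comp_def] using hv)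
    rw [Option.or_none, List.length_map] at eu ev
    apply pair_ext
    · rw [eu, delta_fst]; congr 2; simp only; omega
    · rw [ev, delta_snd]; congr 2; simp only; omega

end Delta

section Transduce

variable {E : Type}

/-- remember the previous letter -/
def phi : Option E → List E → List (Option E × E)
  | _, [] => []
  | s, e :: u => (s, e) :: phi (some e) u

/-- conditions on first and last letter -/
def okf (T' T : Set E) : Option E → List E → Prop
  | none, [] => False
  | some e, [] => e ∈ T
  | s, e :: u => (s = none → e ∈ T') ∧ okf T' T (some e) u

theorem okf_cons (T' T : Set E) (s : Option E) (e : E) (u : List E) :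
    okf T' T s (e :: u) ↔ (s = none → e ∈ T') ∧ okf T' T (some e) u := by
  cases s <;> rfl

theorem AR_phi [Finite E] (T' T : Set E) :
    AR {p : List E × List (Option E × E) | okf T' T none p.1 ∧ p.2 = phi none p.1} := by
  have := reg_of_nfa (σ := Option (Option E)) (α := Option E × Option (Option E × E))
    (fun s w => match s with
      | none => Pd (w.map Prod.fst) [] ∧ Pd (w.map Prod.snd) []
      | some s => ∃ u, okf T' T s u ∧ Pd (w.map Prod.fst) u ∧ Pd (w.map Prod.snd) (phi s u))
    (fun s a t => match s, t with
      | none, none => a = (none, none)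
      | none, some _ => False
      | some s, none => okf T' T s [] ∧ a = (none, none)
      | some s, some t => ∃ e, a = (some e, some (s, e)) ∧ (s = none → e ∈ T') ∧ t = some e) (by
      have hnn : ∀ (a : Option E × Option (Option E × E)) (w : List _),
          (Pd ((a :: w).map Prod.fst) [] ∧ Pd ((a :: w).map Prod.snd) []) ↔
          (a = (none, none) ∧ Pd (w.map Prod.fst) [] ∧ Pd (w.map Prod.snd) []) := by
        rintro ⟨_ | a, _ | b⟩ w <;> simp [Pd_none, Pd_some]
      rintro (_ | s) a w
      · rw [Option.exists]
        simp only [false_and, exists_false, or_false]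
        exact hnn a w
      · rw [Option.exists]
        constructor
        · rintro ⟨u, hok, h1, h2⟩
          cases u with
          | nil =>
            left
            obtain ⟨h3, h4⟩ := (hnn a w).1 ⟨h1, h2⟩
            exact ⟨⟨hok, h3⟩, h4⟩
          | cons e u =>
            right
            obtain ⟨a, b⟩ := a
            rw [okf_cons] at hok
            simp only [List.map_cons] at h1 h2
            cases a with
            | none => have := (Pd_none.1 h1).1; simp at this
            | some a =>
              cases b with
              | none => have := (Pd_none.1 h2).1; simp [phi] at this
              | some b =>
                obtain ⟨u', hu', h1⟩ := Pd_some.1 h1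
                obtain ⟨v', hv', h2⟩ := Pd_some.1 h2
                simp only [List.cons.injEq, phi] at hu' hv'
                obtain ⟨rfl, rfl⟩ := hu'
                obtain ⟨rfl, rfl⟩ := hv'
                exact ⟨some e, ⟨e, rfl, hok.1, rfl⟩, u, hok.2, h1, h2⟩
        · rintro (⟨⟨h1, h2⟩, h3⟩ | ⟨_, ⟨e, rfl, h1, rfl⟩, u, h2, h3, h4⟩)
          · obtain ⟨h4, h5⟩ := (hnn a w).2 ⟨h2, h3⟩
            exact ⟨[], h1, h4, h5⟩
          · refine ⟨e :: u, (okf_cons _ _ _ _ _).2 ⟨h1, h2⟩, Pd_some.2 ⟨u, rfl, h3⟩,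
              Pd_some.2 ⟨_, rfl, h4⟩⟩) (some none)
  refine reg_congr this fun w => ?_
  constructor
  · rintro ⟨u, v, ⟨h1, h2⟩, h3, h4⟩
    simp only at h1 h2
    subst h2
    exact ⟨u, h1, h3, h4⟩
  · rintro ⟨u, h1, h3, h4⟩
    exact ⟨u, _, ⟨h1, rfl⟩, h3, h4⟩

end Transduce

section Main

open Rees

variable {O A I Λ E : Type} (S : Sgpd O A) (R : Rees.Data S I Λ)

theorem Carrier.ext {a b : Carrier S R} (h : a.1 = b.1) : a = b := Subtype.ext h

theorem mul_val (a b : Carrier S R) : (Rees.mul S R a b).1 =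
    (a.1.1, S.mul (S.mul a.1.2.1 (R.P a.1.2.2 b.1.1)) b.1.2.1, b.1.2.2) := rfl

theorem mul_assoc_pre (a b c : Carrier S R) :
    Rees.mul S R (Rees.mul S R a b) c = Rees.mul S R a (Rees.mul S R b c) := by
  obtain ⟨⟨i, x, l⟩, ha1, ha2⟩ := a
  obtain ⟨⟨j, y, m⟩, hb1, hb2⟩ := b
  obtain ⟨⟨k, z, n⟩, hc1, hc2⟩ := c
  apply Carrier.ext
  show (i, S.mul (S.mul (S.mul (S.mul x (R.P l j)) y) (R.P m k)) z, n) =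
    (i, S.mul (S.mul x (R.P l j)) (S.mul (S.mul y (R.P m k)) z), n)
  have p1s := R.P_src l j
  have p1t := R.P_tgt l j
  have p2s := R.P_src m k
  have p2t := R.P_tgt m k
  congr 2
  have e1 : S.tgt x = S.src (R.P l j) := ha2.trans p1s.symm
  have e2 : S.tgt (R.P l j) = S.src y := p1t.trans hb1
  have e3 : S.tgt y = S.src (R.P m k) := hb2.trans p2s.symm
  have e4 : S.tgt (R.P m k) = S.src z := p2t.trans hc1
  have e5 : S.tgt (S.mul x (R.P l j)) = S.src y := by rw [S.tgt_mul _ _ e1, e2]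
  rw [S.mul_assoc' _ y _ e5 e3, S.mul_assoc' _ (S.mul y (R.P m k)) z]
  · rw [S.tgt_mul _ _ e1, S.src_mul _ _ e3, e2]
  · rw [S.tgt_mul _ _ e3, e4]

theorem eval_snoc (S : PreSgpd O A) (lab : E → A) (u : List E) (e : E) (x : A)
    (h : evalPath? S lab u = some x) : evalPath? S lab (u ++ [e]) = some (S.mul x (lab e)) := by
  cases u with
  | nil => simp [evalPath?] at h
  | cons a u =>
    simp only [evalPath?, Option.some.injEq] at h
    simp [evalPath?, h]

theorem eval_ne (S : PreSgpd O A) (lab : E → A) (u : List E) (h : u ≠ []) :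
    ∃ x, evalPath? S lab u = some x := by
  cases u with
  | nil => exact absurd rfl h
  | cons a u => exact ⟨_, rfl⟩

variable {S R}
variable (C : ChoiceOfReps (Rees.pre S R) E)

/-- right multiplication relation -/
def relMul (m : Carrier S R) : Set (List E × List E) :=
  {p | p.1 ∈ C.K ∧ p.2 ∈ C.K ∧ ∃ x, evalPath? (Rees.pre S R) C.lab p.1 = some x ∧
    evalPath? (Rees.pre S R) C.lab p.2 = some (Rees.mul S R x m)}

theorem AR_eq (h : IsAutomaticStructure C) : AR (relEq C) := by
  have := AR_of_sync _ (h.2.2.2 ())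
  convert this using 1
  ext ⟨u, v⟩
  constructor
  · rintro ⟨h1, h2, h3⟩
    refine ⟨h1, h2, ?_, h3⟩
    have := (C.K_path u h1).1
    simp only [pathTgt?, List.getLast?_eq_some_getLast this, Option.map_some]
  · rintro ⟨h1, h2, _, h3⟩
    exact ⟨h1, h2, h3⟩

theorem AR_mul_lab (h : IsAutomaticStructure C) (e : E) : AR (relMul C (C.lab e)) := by
  have := AR_of_sync _ (h.2.2.1 e)
  convert this using 1
  ext ⟨u, v⟩
  constructor
  · rintro ⟨h1, h2, x, h3, h4⟩
    refine ⟨h1, h2, ?_, ?_⟩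
    · have := (C.K_path u h1).1
      simp only [pathTgt?, List.getLast?_eq_some_getLast this, Option.map_some]
    · simp only at h3 h4 ⊢
      rw [eval_snoc _ _ _ _ _ h3, h4]
      rfl
  · rintro ⟨h1, h2, _, h3⟩
    refine ⟨h1, h2, ?_⟩
    obtain ⟨x, hx⟩ := eval_ne (Rees.pre S R) C.lab u (C.K_path u h1).1
    simp only at h3
    rw [eval_snoc _ _ _ _ _ hx] at h3
    exact ⟨x, hx, h3.symm⟩

theorem AR_mul_mul {m n : Carrier S R} (hm : AR (relMul C m)) (hn : AR (relMul C n)) :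
    AR (relMul C (Rees.mul S R m n)) := by
  have := hm.comp hn
  convert this using 1
  ext ⟨u, v⟩
  constructor
  · rintro ⟨h1, h2, x, h3, h4⟩
    obtain ⟨w, hw, hwe⟩ := C.K_onto (Rees.mul S R x m)
    refine ⟨w, ⟨h1, hw, x, h3, hwe⟩, ⟨hw, h2, _, hwe, ?_⟩⟩
    rw [mul_assoc_pre]; exact h4
  · rintro ⟨w, ⟨h1, hw, x, h3, hwe⟩, ⟨_, h2, y, hy, h4⟩⟩
    simp only at *
    rw [hwe] at hy
    obtain rfl := Option.some.inj hy
    refine ⟨h1, h2, x, h3, ?_⟩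
    rw [← mul_assoc_pre]; exact h4

theorem AR_mul (h : IsAutomaticStructure C) (m : Carrier S R) : AR (relMul C m) := by
  obtain ⟨u, _, hu⟩ := C.K_onto m
  have key : ∀ (l : List E) (m : Carrier S R), AR (relMul C m) →
      AR (relMul C ((l.map C.lab).foldl (Rees.mul S R) m)) := by
    intro l
    induction l with
    | nil => intro m hm; exact hm
    | cons e l ih => intro m hm; exact ih _ (AR_mul_mul C hm (AR_mul_lab C h e))
  cases u with
  | nil => simp [evalPath?] at hu
  | cons e l =>
    obtain rfl := Option.some.inj hu
    exact key l _ (AR_mul_lab C h e)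

/-- pairs with prescribed values -/
theorem AR_const (h : IsAutomaticStructure C) (m n : Carrier S R) :
    AR {p : List E × List E | p.1 ∈ C.K ∧ p.2 ∈ C.K ∧
      evalPath? (Rees.pre S R) C.lab p.1 = some m ∧
      evalPath? (Rees.pre S R) C.lab p.2 = some n} := by
  obtain ⟨u, hu, hum⟩ := C.K_onto m
  obtain ⟨v, hv, hvn⟩ := C.K_onto n
  have := (AR_eq C h).comp ((AR_singleton u v).comp (AR_eq C h))
  convert this using 1
  ext ⟨a, b⟩
  constructor
  · rintro ⟨h1, h2, h3, h4⟩
    exact ⟨u, ⟨h1, hu, h3.trans hum.symm⟩, v, rfl, hv, h2, hvn.trans h4.symm⟩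
  · rintro ⟨u', ⟨h1, h2, h3⟩, v', h4, h5, h6, h7⟩
    obtain ⟨rfl, rfl⟩ := Prod.mk.inj h4
    exact ⟨h1, h6, h3.trans hum, h7.symm.trans hvn⟩

/-- right multiplication by an arrow `t` of `S` -/
def relArrow (mu : O → Λ) (t : A) : Set (List E × List E) :=
  {p | p.1 ∈ C.K ∧ p.2 ∈ C.K ∧ ∃ x y : Carrier S R,
    evalPath? (Rees.pre S R) C.lab p.1 = some x ∧
    evalPath? (Rees.pre S R) C.lab p.2 = some y ∧
    S.tgt x.1.2.1 = S.src t ∧ y.1 = (x.1.1, S.mul x.1.2.1 t, mu (S.tgt t))}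

/-- the element `x t` -/
def arrowElt (mu : O → Λ) (hmu : ∀ v, R.G (mu v) = v) (t : A) (x : Carrier S R)
    (h : S.tgt x.1.2.1 = S.src t) : Carrier S R :=
  ⟨(x.1.1, S.mul x.1.2.1 t, mu (S.tgt t)), by
    constructor
    · simp only [S.src_mul _ _ h]; exact x.2.1
    · simp only [S.tgt_mul _ _ h, hmu]⟩

theorem arrowElt_mul (mu : O → Λ) (hmu : ∀ v, R.G (mu v) = v) (t : A) (w x : Carrier S R)
    (h : S.tgt x.1.2.1 = S.src t) (h' : S.tgt (Rees.mul S R w x).1.2.1 = S.src t) :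
    Rees.mul S R w (arrowElt mu hmu t x h) = arrowElt mu hmu t (Rees.mul S R w x) h' := by
  apply Carrier.ext
  show (w.1.1, S.mul (S.mul w.1.2.1 (R.P w.1.2.2 x.1.1)) (S.mul x.1.2.1 t), mu (S.tgt t)) =
    (w.1.1, S.mul (S.mul (S.mul w.1.2.1 (R.P w.1.2.2 x.1.1)) x.1.2.1) t, mu (S.tgt t))
  congr 2
  refine (S.mul_assoc' _ _ _ ?_ h).symm
  rw [S.tgt_mul, R.P_tgt]
  · exact x.2.1
  · rw [R.P_src]; exact w.2.2

theorem tgt_mul_pre (w x : Carrier S R) :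
    S.tgt (Rees.mul S R w x).1.2.1 = S.tgt x.1.2.1 :=
  (Rees.mul S R w x).2.2.trans x.2.2.symm

theorem AR_arrow (h : IsAutomaticStructure C) (mu : O → Λ) (hmu : ∀ v, R.G (mu v) = v) (t : A) :
    AR (relArrow C mu t) := by
  have hE : Finite E := h.1
  have key := AR.iUnion (ι := {e : E // S.tgt (C.lab e).1.2.1 = S.src t}) _ (fun e =>
    ((AR_mul_lab C h e.1).swap.comp (AR_mul C h (arrowElt mu hmu t (C.lab e.1) e.2))).union
    (AR_const C h (C.lab e.1) (arrowElt mu hmu t (C.lab e.1) e.2)))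
  convert key using 1
  ext ⟨u, v⟩
  constructor
  · rintro ⟨h1, h2, x, y, hx, hy, hxt, hyx⟩
    simp only at hx hy
    rcases List.eq_nil_or_concat' u with rfl | ⟨u', e, rfl⟩
    · simp [evalPath?] at hx
    · by_cases hu' : u' = []
      · subst hu'
        have : C.lab e = x := Option.some.inj hx
        subst this
        refine ⟨⟨e, hxt⟩, Or.inr ⟨h1, h2, hx, ?_⟩⟩
        rw [hy]
        congr 1
        exact Carrier.ext S R hyx
      · obtain ⟨z, hz⟩ := eval_ne (Rees.pre S R) C.lab u' hu'
        rw [eval_snoc _ _ _ _ _ hz] at hx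
        have hx' : Rees.mul S R z (C.lab e) = x := Option.some.inj hx
        subst hx'
        have hxt' := hxt
        rw [tgt_mul_pre] at hxt'
        obtain ⟨w, hw, hwz⟩ := C.K_onto z
        refine ⟨⟨e, hxt'⟩, Or.inl ⟨w, ⟨hw, h1, z, hwz, ?_⟩, ⟨hw, h2, z, hwz, ?_⟩⟩⟩
        · exact eval_snoc _ _ _ _ _ hz
        · simp only
          rw [hy, arrowElt_mul mu hmu t z _ hxt' hxt]
          congr 1
          exact Carrier.ext S R hyx
  · rintro ⟨⟨e, he⟩, ⟨w, ⟨hw, h1, z, hwz, hu⟩, ⟨_, h2, z', hwz', hv⟩⟩ | ⟨h1, h2, hu, hv⟩⟩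
    · simp only at *
      rw [hwz] at hwz'
      obtain rfl := Option.some.inj hwz'
      have ht : S.tgt (Rees.mul S R z (C.lab e)).1.2.1 = S.src t := by rw [tgt_mul_pre, he]
      refine ⟨h1, h2, _, _, hu, hv, ht, ?_⟩
      rw [arrowElt_mul mu hmu t z _ he ht]
      rfl
    · exact ⟨h1, h2, _, _, hu, hv, he, rfl⟩


/-- new edge labels -/
def labY : Option E × E → A
  | (none, e) => (C.lab e).1.2.1
  | (some e', e) => S.mul (R.P (C.lab e').1.2.2 (C.lab e).1.1) (C.lab e).1.2.1

/-- new edge sources -/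
def srcY : Option E × E → O
  | (none, e) => R.F (C.lab e).1.1
  | (some e', _) => R.G (C.lab e').1.2.2

/-- new edge targets -/
def tgtY (y : Option E × E) : O := R.G (C.lab y.2).1.2.2

theorem P_src_lab (e : E) (l : Λ) :
    S.tgt (R.P l (C.lab e).1.1) = S.src (C.lab e).1.2.1 :=
  (R.P_tgt _ _).trans (C.lab e).2.1

theorem labY_src (y : Option E × E) : S.src (labY C y) = srcY C y := by
  obtain ⟨_ | e', e⟩ := y
  · exact (C.lab e).2.1.symm
  · simp only [labY, srcY]
    rw [S.src_mul _ _ (P_src_lab C e _), R.P_src]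

theorem labY_tgt (y : Option E × E) : S.tgt (labY C y) = tgtY C y := by
  obtain ⟨_ | e', e⟩ := y
  · exact (C.lab e).2.2
  · simp only [labY, tgtY]
    rw [S.tgt_mul _ _ (P_src_lab C e _)]
    exact (C.lab e).2.2

theorem foldl_i (l : List E) (m : Carrier S R) :
    ((l.map C.lab).foldl (Rees.mul S R) m).1.1 = m.1.1 := by
  induction l generalizing m with
  | nil => rfl
  | cons e l ih => exact ih _

theorem foldl_x (l : List E) (e : E) (m : Carrier S R) (hm : m.1.2.2 = (C.lab e).1.2.2) :
    ((phi (some e) l).map (labY C)).foldl S.mul m.1.2.1 =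
      ((l.map C.lab).foldl (Rees.mul S R) m).1.2.1 := by
  induction l generalizing e m with
  | nil => rfl
  | cons f l ih =>
    have := ih f (Rees.mul S R m (C.lab f)) rfl
    simp only [phi, List.map_cons, List.foldl_cons]
    rw [← this]
    congr 1
    show S.mul m.1.2.1 (S.mul (R.P (C.lab e).1.2.2 (C.lab f).1.1) (C.lab f).1.2.1) =
      S.mul (S.mul m.1.2.1 (R.P m.1.2.2 (C.lab f).1.1)) (C.lab f).1.2.1
    rw [S.mul_assoc', hm]
    · rw [R.P_src]; exact m.2.2
    · exact P_src_lab C f _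

theorem foldl_ok (pI : Set I) (pL : Set Λ) (l : List E) (e : E) (m : Carrier S R)
    (hm : m.1.2.2 = (C.lab e).1.2.2) :
    okf {e | (C.lab e).1.1 ∈ pI} {e | (C.lab e).1.2.2 ∈ pL} (some e) l ↔
      ((l.map C.lab).foldl (Rees.mul S R) m).1.2.2 ∈ pL := by
  induction l generalizing e m with
  | nil =>
    show (C.lab e).1.2.2 ∈ pL ↔ m.1.2.2 ∈ pL
    rw [hm]
  | cons f l ih =>
    rw [okf_cons]
    refine Iff.trans ?_ (ih f (Rees.mul S R m (C.lab f)) rfl)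
    simp

theorem foldl_tgt (l : List E) (s : Option E) (e : E) (m : Carrier S R)
    (hm : m.1.2.2 = (C.lab e).1.2.2) :
    pathTgt? (tgtY C) ((s, e) :: phi (some e) l) =
      some (R.G ((l.map C.lab).foldl (Rees.mul S R) m).1.2.2) := by
  induction l generalizing s e m with
  | nil =>
    show some (R.G (C.lab e).1.2.2) = some (R.G m.1.2.2)
    rw [hm]
  | cons f l ih =>
    have := ih (some e) f (Rees.mul S R m (C.lab f)) rfl
    simp only [phi, pathTgt?, List.getLast?_cons_cons] at this ⊢
    exact this

theorem phi_chain (l : List E) (s : Option E) (e : E) :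
    IsPathChain (srcY C) (tgtY C) ((s, e) :: phi (some e) l) := by
  induction l generalizing s e with
  | nil => exact List.isChain_singleton _
  | cons f l ih => exact List.isChain_cons_cons.2 ⟨rfl, ih (some e) f⟩

theorem okf_iff (pI : Set I) (pL : Set Λ) (u : List E) (m : Carrier S R)
    (hm : evalPath? (Rees.pre S R) C.lab u = some m) :
    okf {e | (C.lab e).1.1 ∈ pI} {e | (C.lab e).1.2.2 ∈ pL} none u ↔
      m.1.1 ∈ pI ∧ m.1.2.2 ∈ pL := by
  cases u with
  | nil => simp [evalPath?] at hm
  | cons e l =>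
    obtain rfl := Option.some.inj hm
    rw [okf_cons, foldl_ok C pI pL l e (C.lab e) rfl]
    have := foldl_i C l (C.lab e)
    show _ ↔ ((l.map C.lab).foldl (Rees.mul S R) (C.lab e)).1.1 ∈ pI ∧ _
    rw [this]
    simp only [forall_const]
    rfl

theorem eval_phi (u : List E) (m : Carrier S R)
    (hm : evalPath? (Rees.pre S R) C.lab u = some m) :
    evalPath? S.toPreSgpd (labY C) (phi none u) = some m.1.2.1 := by
  cases u with
  | nil => simp [evalPath?] at hm
  | cons e l =>
    obtain rfl := Option.some.inj hm
    exact congrArg some (foldl_x C l e (C.lab e) rfl)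

theorem tgt_phi (u : List E) (m : Carrier S R)
    (hm : evalPath? (Rees.pre S R) C.lab u = some m) :
    pathTgt? (tgtY C) (phi none u) = some (S.tgt m.1.2.1) := by
  have h2 : S.tgt m.1.2.1 = R.G m.1.2.2 := m.2.2
  rw [h2]
  cases u with
  | nil => simp [evalPath?] at hm
  | cons e l =>
    obtain rfl := Option.some.inj hm
    exact foldl_tgt C l none e (C.lab e) rfl

theorem surj_G (hne : Nonempty A) (hiso : IsolationFree S.toPreSgpd) (v : O) :
    ∃ e, R.G (C.lab e).1.2.2 = v := by
  have key : ∀ a : A, S.tgt a = v → ∃ e, R.G (C.lab e).1.2.2 = v := by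
    intro a ha
    obtain ⟨l, hl⟩ := R.G_onto a
    obtain ⟨i, hi⟩ := R.F_onto a
    obtain ⟨u, _, hu⟩ := C.K_onto ⟨(i, a, l), hi, hl.symm⟩
    rcases List.eq_nil_or_concat' u with rfl | ⟨u', e, rfl⟩
    · simp [evalPath?] at hu
    · refine ⟨e, ?_⟩
      have h1 := tgt_phi C _ _ hu
      by_cases hu' : u' = []
      · subst hu'
        have h2 : C.lab e = _ := Option.some.inj hu
        rw [h2]
        exact hl.trans ha
      · obtain ⟨z, hz⟩ := eval_ne (Rees.pre S R) C.lab u' hu'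
        rw [eval_snoc _ _ _ _ _ hz] at hu
        have h2 : Rees.mul S R z (C.lab e) = _ := Option.some.inj hu
        have h3 : (Rees.mul S R z (C.lab e)).1.2.2 = l := by rw [h2]
        have h4 : (C.lab e).1.2.2 = l := h3
        rw [h4]
        exact hl.trans ha
  obtain ⟨a, ha | ha⟩ := hiso v
  · obtain ⟨i, hi⟩ := R.F_onto a
    obtain ⟨l, _⟩ := R.G_onto a
    exact key (R.P l i) ((R.P_tgt l i).trans (hi.trans ha))
  · exact key a ha

end Main

/-- Theorem 6.2: if a Rees matrix semigroup without zero is automatic and the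
non-identity arrows of `S` are weakly right-ideal-generated by a row
cross-section of `P`, then `S` is automatic. -/
theorem stmt_16 {O A I Λ : Type} (S : Sgpd O A) (hne : Nonempty A)
    (hiso : IsolationFree S.toPreSgpd)
    (R : Rees.Data S I Λ)
    (hrig : Rees.WeaklyRIG S R { a : A | ¬ IsIdentity S.toPreSgpd a })
    (hM : IsAutomatic (Rees.pre S R)) :
    IsAutomatic S.toPreSgpd := by
  obtain ⟨E, C, hC⟩ := hM
  have hE : Finite E := hC.1
  have hsurj := surj_G C hne hiso
  have hO : Finite O := Finite.of_surjective (fun e => R.G (C.lab e).1.2.2) hsurj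
  have hmu : ∃ mu : O → Λ, ∀ v, R.G (mu v) = v :=
    ⟨fun v => (C.lab (hsurj v).choose).1.2.2, fun v => (hsurj v).choose_spec⟩
  obtain ⟨mu, hmu⟩ := hmu
  have hnu : ∀ v, ∃ i, R.F i = v := by
    intro v
    obtain ⟨e, he⟩ := hsurj v
    obtain ⟨i, hi⟩ := R.F_onto (R.P (C.lab e).1.2.2 (C.lab e).1.1)
    exact ⟨i, hi.trans ((R.P_src _ _).trans he)⟩
  choose nu hnu using hnu
  let pI : Set I := {i | nu (R.F i) = i}
  let pL : Set Λ := {l | mu (R.G l) = l}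
  let T' : Set E := {e | (C.lab e).1.1 ∈ pI}
  let T : Set E := {e | (C.lab e).1.2.2 ∈ pL}
  have hext : ∀ (u : List E) (m : Rees.Carrier S R),
      evalPath? (Rees.pre S R) C.lab u = some m → okf T' T none u →
      m.1 = (nu (S.src m.1.2.1), m.1.2.1, mu (S.tgt m.1.2.1)) := by
    intro u m hm hok
    obtain ⟨h1, h2⟩ := (okf_iff C pI pL u m hm).1 hok
    have h3 : R.F m.1.1 = S.src m.1.2.1 := m.2.1
    have h4 : S.tgt m.1.2.1 = R.G m.1.2.2 := m.2.2
    have h1' : nu (R.F m.1.1) = m.1.1 := h1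
    have h2' : mu (R.G m.1.2.2) = m.1.2.2 := h2
    rw [← h3, h4, h1', h2']
  let C' : ChoiceOfReps S.toPreSgpd (Option E × E) :=
    { esrc := srcY C
      etgt := tgtY C
      lab := labY C
      lab_src := labY_src C
      lab_tgt := labY_tgt C
      K := {y | ∃ u ∈ C.K, okf T' T none u ∧ y = phi none u}
      K_path := by
        rintro _ ⟨u, hu, hok, rfl⟩
        cases u with
        | nil => exact hok.elim
        | cons e l => exact ⟨by simp [phi], phi_chain C l none e⟩
      K_onto := by
        intro a
        obtain ⟨u, hu, hm⟩ := C.K_onto ⟨(nu (S.src a), a, mu (S.tgt a)), hnu _, (hmu _).symm⟩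
        refine ⟨_, ⟨u, hu, ?_, rfl⟩, eval_phi C u _ hm⟩
        refine (okf_iff C pI pL u _ hm).2 ⟨?_, ?_⟩
        · show nu (R.F (nu (S.src a))) = nu (S.src a)
          rw [hnu]
        · show mu (R.G (mu (S.tgt a))) = mu (S.tgt a)
          rw [hmu] }
  have hphi := AR_phi T' T
  have hev : ∀ u ∈ C.K, ∃ m, evalPath? (Rees.pre S R) C.lab u = some m :=
    fun u hu => eval_ne _ _ u (C.K_path u hu).1
  refine ⟨Option E × E, C', inferInstance, ?_, ?_, ?_⟩
  · have := ((hphi.swap.comp (AR_eq C hC)).comp hphi).diag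
    refine reg_congr this fun y => ?_
    constructor
    · rintro ⟨u, hu, hok, rfl⟩
      exact ⟨u, ⟨u, ⟨hok, rfl⟩, hu, hu, rfl⟩, hok, rfl⟩
    · rintro ⟨u, ⟨_, _, _, hu, _⟩, hok, hy⟩
      exact ⟨u, hu, hok, hy⟩
  · intro a
    apply sync_of_AR
    have := (hphi.swap.comp (AR_arrow C hC mu hmu (labY C a))).comp hphi
    convert this using 1
    ext ⟨y, y'⟩
    constructor
    · rintro ⟨⟨u, hu, hok, hy⟩, ⟨v, hv, hok', hy'⟩, h1, h2⟩
      simp only at hy hy' h1 h2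
      subst hy hy'
      obtain ⟨m, hm⟩ := hev u hu
      obtain ⟨n, hn⟩ := hev v hv
      refine ⟨v, ⟨u, ⟨hok, rfl⟩, hu, hv, m, n, hm, hn, ?_⟩, hok', rfl⟩
      have h1' := (tgt_phi C u m hm).symm.trans h1
      have ht : S.tgt m.1.2.1 = S.src (labY C a) := (Option.some.inj h1').trans (labY_src C a).symm
      have h2' := (eval_snoc S.toPreSgpd (labY C) _ a _ (eval_phi C u m hm)).symm.trans
        (h2.trans (eval_phi C v n hn))
      have hx : S.mul m.1.2.1 (labY C a) = n.1.2.1 := Option.some.inj h2'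
      refine ⟨ht, ?_⟩
      rw [hext v n hn hok', ← hx, S.src_mul _ _ ht, S.tgt_mul _ _ ht]
      have h5 := congrArg Prod.fst (hext u m hm hok)
      simp only at h5
      rw [← h5]
    · rintro ⟨v, ⟨u, ⟨hok, hy⟩, hu, hv, m, n, hm, hn, ht, hmn⟩, hok', hy'⟩
      simp only at hy hy' hm hn
      subst hy hy'
      refine ⟨⟨u, hu, hok, rfl⟩, ⟨v, hv, hok', rfl⟩, ?_, ?_⟩
      · exact (tgt_phi C u m hm).trans (congrArg some (ht.trans (labY_src C a)))
      · refine (eval_snoc S.toPreSgpd (labY C) _ a _ (eval_phi C u m hm)).trans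
          (Eq.trans ?_ (eval_phi C v n hn).symm)
        rw [hmn]
  · intro v
    apply sync_of_AR
    let pLv : Set Λ := {l | mu (R.G l) = l ∧ R.G l = v}
    have := ((AR_phi T' {e | (C.lab e).1.2.2 ∈ pLv}).swap.comp (AR_eq C hC)).comp hphi
    convert this using 1
    ext ⟨y, y'⟩
    constructor
    · rintro ⟨⟨u, hu, hok, hy⟩, ⟨w, hw, hok', hy'⟩, h1, h2⟩
      simp only at hy hy' h1 h2
      subst hy hy'
      obtain ⟨m, hm⟩ := hev u hu
      obtain ⟨n, hn⟩ := hev w hw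
      have h1' := Option.some.inj ((tgt_phi C u m hm).symm.trans h1)
      have h2' : m.1.2.1 = n.1.2.1 :=
        Option.some.inj ((eval_phi C u m hm).symm.trans (h2.trans (eval_phi C w n hn)))
      refine ⟨w, ⟨u, ⟨?_, rfl⟩, hu, hw, ?_⟩, hok', rfl⟩
      · obtain ⟨h3, h4⟩ := (okf_iff C pI pL u m hm).1 hok
        have h5 : S.tgt m.1.2.1 = R.G m.1.2.2 := m.2.2
        exact (okf_iff C pI pLv u m hm).2 ⟨h3, h4, h5.symm.trans h1'⟩
      · simp only
        rw [hm, hn]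
        congr 1
        apply Carrier.ext
        rw [hext u m hm hok, hext w n hn hok', h2']
    · rintro ⟨w, ⟨u, ⟨hok, hy⟩, hu, hw, h1⟩, hok', hy'⟩
      simp only at hy hy' h1
      subst hy hy'
      obtain ⟨m, hm⟩ := hev u hu
      have hn := h1.symm.trans hm
      obtain ⟨h3, h4, h5⟩ := (okf_iff C pI pLv u m hm).1 hok
      refine ⟨⟨u, hu, (okf_iff C pI pL u m hm).2 ⟨h3, h4⟩, rfl⟩, ⟨w, hw, hok', rfl⟩, ?_, ?_⟩
      · have h6 : S.tgt m.1.2.1 = R.G m.1.2.2 := m.2.2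
        exact (tgt_phi C u m hm).trans (congrArg some (h6.trans h5))
      · exact (eval_phi C u m hm).trans (eval_phi C w m hn).symm

end AutoRees
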